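/- arXiv:1301.4465 — 4 statements merged into one kernel-verified Lean document; each statement's English description precedes it below -/
import Mathlib

section
/- Let φ be an Orlicz function, let w(1) ≥ w(2) ≥ … ≥ w(n) > 0 be a finite decreasing positive weight sequence, and let x = (x(1),…,x(n)) be any finite sequence of real numbers with decreasing rearrangement x*. Then ∑_{i=1}^n φ(x*(i)/w(i)) w(i) = inf { ∑_{i=1}^n φ(x*(i)/w(σ(i))) w(σ(i)) : σ a permutation of {1,…,n} }; in particular the infimum is attained at the identity permutation, i.e. ∑_{i=1}^n φ(x*(i)/w(i)) w(i) ≤ ∑_{i=1}^n φ(x*(i)/w(σ(i))) w(σ(i)) for every permutation σ of {1,…,n}. -/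
open MeasureTheory Set Filter Topology ENNReal

noncomputable section

namespace OrliczRearrangement

/-- An Orlicz function: convex on `[0,∞)`, strictly increasing on `[0,∞)` and vanishing at `0`. -/
def IsOrliczFn (φ : ℝ → ℝ) : Prop :=
  ConvexOn ℝ (Set.Ici 0) φ ∧ StrictMonoOn φ (Set.Ici 0) ∧ φ 0 = 0

/-- An `N`-function: an Orlicz function with `φ(t)/t → 0` as `t → 0⁺` and `φ(t)/t → ∞`
as `t → ∞`. -/
def IsNFn (φ : ℝ → ℝ) : Prop :=
  IsOrliczFn φ ∧ Filter.Tendsto (fun t => φ t / t) (nhdsWithin 0 (Set.Ioi 0)) (nhds 0) ∧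
    Filter.Tendsto (fun t => φ t / t) Filter.atTop Filter.atTop

/-- The complementary (conjugate) function `φ*(t) = sup_{s>0} (st - φ(s))`. -/
def conjFn (φ : ℝ → ℝ) (t : ℝ) : ℝ := sSup ((fun s => s * t - φ s) '' Set.Ioi 0)

/-- The interval `I = (0,a)`, `0 < a ≤ ∞`, as a subset of `ℝ`. -/
def Ioa' (a : ℝ≥0∞) : Set ℝ := {t : ℝ | 0 < t ∧ ENNReal.ofReal t < a}

/-- Distribution function `d_f(s) = |{t ∈ (0,a) : |f(t)| > s}|`. -/
def distr (a : ℝ≥0∞) (f : ℝ → ℝ) (s : ℝ) : ℝ≥0∞ := volume {t ∈ Ioa' a | s < |f t|}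

/-- Decreasing rearrangement `f*(t) = inf{s ≥ 0 : d_f(s) ≤ t}` of `f` on `(0,a)`,
with value `∞` when no such `s` exists. -/
def decRe (a : ℝ≥0∞) (f : ℝ → ℝ) (t : ℝ) : ℝ≥0∞ :=
  sInf (ENNReal.ofReal '' {s : ℝ | 0 ≤ s ∧ distr a f s ≤ ENNReal.ofReal t})

/-- Distribution of a sequence: `d_x(s) = |{k : |x(k)| > s}|`. -/
def sdistr (x : ℕ → ℝ) (s : ℝ) : ℕ∞ := {k : ℕ | s < |x k|}.encard

/-- Decreasing rearrangement of a sequence (`0`-indexed):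
`x*(n) = inf{s > 0 : d_x(s) ≤ n}`, with value `∞` when no such `s` exists. -/
def sdecRe (x : ℕ → ℝ) (n : ℕ) : ℝ≥0∞ :=
  sInf (ENNReal.ofReal '' {s : ℝ | 0 < s ∧ sdistr x s ≤ (n : ℕ∞)})

/-- The extended-real quantity `φ(c/v)·v`, with the convention that for `v = 0` it equals
`0` if `c = 0` and `∞` if `c ≠ 0`. -/
def oterm (φ : ℝ → ℝ) (c v : ℝ) : ℝ≥0∞ :=
  if v = 0 then (if c = 0 then 0 else ∞) else ENNReal.ofReal (φ (c / v) * v)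

/-- The quantity `φ(c/v)·v` for an extended-real numerator `c`; it equals `∞` when
`c = ∞`. -/
def otermE (φ : ℝ → ℝ) (c : ℝ≥0∞) (v : ℝ) : ℝ≥0∞ :=
  if c = ∞ then ∞ else oterm φ c.toReal v

/-- The modular `M(f) = ∫_I φ(f*/w)·w`. -/
def Mmod (a : ℝ≥0∞) (φ w f : ℝ → ℝ) : ℝ≥0∞ :=
  ∫⁻ t in Ioa' a, otermE φ (decRe a f t) (w t)

/-- The functional `‖f‖_M = inf{ε > 0 : M(f/ε) ≤ 1}` (equal to `∞` if no such `ε`). -/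
def Mnorm (a : ℝ≥0∞) (φ w f : ℝ → ℝ) : ℝ≥0∞ :=
  ⨅ ε ∈ {ε : ℝ | 0 < ε ∧ Mmod a φ w (fun t => f t / ε) ≤ 1}, ENNReal.ofReal ε

/-- The class `M_{φ,w}` of measurable `f` with `M(λf) < ∞` for some `λ > 0`. -/
def Mclass (a : ℝ≥0∞) (φ w : ℝ → ℝ) : Set (ℝ → ℝ) :=
  {f | Measurable f ∧ ∃ c > 0, Mmod a φ w (fun t => c * f t) < ∞}

/-- Submajorization `v ≺ w` on `(0,a)`: `∫₀ᵗ v* ≤ ∫₀ᵗ w*` for all `t ∈ (0,a)`. -/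
def Submaj (a : ℝ≥0∞) (v w : ℝ → ℝ) : Prop :=
  ∀ t ∈ Ioa' a, ∫⁻ s in Set.Ioo 0 t, decRe a v s ≤ ∫⁻ s in Set.Ioo 0 t, decRe a w s

/-- The modular `P`, for (decreasing-rearrangement-like) `[0,∞]`-valued data `F`:
`P(F) = inf{∫_I φ(F/v)·v : v ≥ 0, v ≺ w}`. -/
def PmodE (a : ℝ≥0∞) (φ w : ℝ → ℝ) (F : ℝ → ℝ≥0∞) : ℝ≥0∞ :=
  ⨅ v ∈ {v : ℝ → ℝ | Measurable v ∧ (∀ t, 0 ≤ v t) ∧ Submaj a v w},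
    ∫⁻ t in Ioa' a, otermE φ (F t) (v t)

/-- The modular `P(f) = inf{∫_I φ(|f|/v)·v : v ≥ 0, v ≺ w}`. -/
def Pmod (a : ℝ≥0∞) (φ w f : ℝ → ℝ) : ℝ≥0∞ :=
  PmodE a φ w fun t => ENNReal.ofReal |f t|

/-- The norm of `𝓜_{φ,w}` for `[0,∞]`-valued data. -/
def PnormE (a : ℝ≥0∞) (φ w : ℝ → ℝ) (F : ℝ → ℝ≥0∞) : ℝ≥0∞ :=
  ⨅ ε ∈ {ε : ℝ | 0 < ε ∧ PmodE a φ w (fun t => F t / ENNReal.ofReal ε) ≤ 1},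
    ENNReal.ofReal ε

/-- The norm `‖f‖_𝓜 = inf{ε > 0 : P(f/ε) ≤ 1}`. -/
def Pnorm (a : ℝ≥0∞) (φ w f : ℝ → ℝ) : ℝ≥0∞ :=
  PnormE a φ w fun t => ENNReal.ofReal |f t|

/-- The space `𝓜_{φ,w}` of measurable `f` with `P(λf) < ∞` for some `λ > 0`. -/
def Pclass (a : ℝ≥0∞) (φ w : ℝ → ℝ) : Set (ℝ → ℝ) :=
  {f | Measurable f ∧ ∃ c > 0, Pmod a φ w (fun t => c * f t) < ∞}

/-- Sequence submajorization `v ≺ w`. -/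
def sSubmaj (v w : ℕ → ℝ) : Prop :=
  ∀ m : ℕ, ∑ n ∈ Finset.range m, sdecRe v n ≤ ∑ n ∈ Finset.range m, sdecRe w n

/-- Sequence modular `p` for `[0,∞]`-valued data. -/
def spmodE (φ : ℝ → ℝ) (w : ℕ → ℝ) (X : ℕ → ℝ≥0∞) : ℝ≥0∞ :=
  ⨅ v ∈ {v : ℕ → ℝ | (∀ n, 0 ≤ v n) ∧ sSubmaj v w}, ∑' n, otermE φ (X n) (v n)

/-- Sequence modular `p(x) = inf{∑ φ(|x(n)|/v(n))·v(n) : v ≥ 0, v ≺ w}`. -/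
def spmod (φ : ℝ → ℝ) (w x : ℕ → ℝ) : ℝ≥0∞ :=
  spmodE φ w fun n => ENNReal.ofReal |x n|

/-- Sequence norm for `[0,∞]`-valued data. -/
def spnormE (φ : ℝ → ℝ) (w : ℕ → ℝ) (X : ℕ → ℝ≥0∞) : ℝ≥0∞ :=
  ⨅ ε ∈ {ε : ℝ | 0 < ε ∧ spmodE φ w (fun n => X n / ENNReal.ofReal ε) ≤ 1},
    ENNReal.ofReal ε

/-- Sequence norm `‖x‖_𝔪 = inf{ε > 0 : p(x/ε) ≤ 1}`. -/
def spnorm (φ : ℝ → ℝ) (w x : ℕ → ℝ) : ℝ≥0∞ :=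
  spnormE φ w fun n => ENNReal.ofReal |x n|

/-- Dilation operator `D₂f(t) = f(t/2)`, where `f` is extended by `0` outside `(0,a)`. -/
def D2 (a : ℝ≥0∞) (f : ℝ → ℝ) : ℝ → ℝ := fun t => (Ioa' a).indicator f (t / 2)

/-- A measure preserving transformation from `S` onto `S`. -/
def MeasPresOn (σ : ℝ → ℝ) (S : Set ℝ) : Prop :=
  Set.MapsTo σ S S ∧ Set.SurjOn σ S S ∧ Measurable σ ∧
    ∀ A : Set ℝ, A ⊆ S → MeasurableSet A → volume (S ∩ σ ⁻¹' A) = volume A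

/-- Luxemburg norm of the weighted Orlicz space `L_φ(w)` on `(0,a)`. -/
def luxNorm (a : ℝ≥0∞) (φ w g : ℝ → ℝ) : ℝ≥0∞ :=
  ⨅ ε ∈ {ε : ℝ | 0 < ε ∧
      ∫⁻ t in Ioa' a, ENNReal.ofReal (φ (|g t| / ε) * w t) ≤ 1}, ENNReal.ofReal ε

/-- The Orlicz norm of `f` in `Λ_{φ*,w}`, defined by duality with the unit ball of
`L_φ(w)`: `‖f‖⁰ = sup{∫_I f° g w : g ≥ 0, ‖g‖_{L_φ(w)} ≤ 1}`. -/
def lamOnorm (a : ℝ≥0∞) (φ w f : ℝ → ℝ) : ℝ≥0∞ :=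
  ⨆ g ∈ {g : ℝ → ℝ | Measurable g ∧ (∀ t, 0 ≤ g t) ∧ luxNorm a φ w g ≤ 1},
    ∫⁻ t in Ioa' a, decRe a f t * ENNReal.ofReal (g t * w t)

/-- The Orlicz–Lorentz class `Λ_{φs,w}`: measurable `g` whose (finite) decreasing
rearrangement satisfies `∫_I φs(c·g°)·w < ∞` for some `c > 0`. -/
def LamClass (a : ℝ≥0∞) (φs w : ℝ → ℝ) : Set (ℝ → ℝ) :=
  {g | Measurable g ∧ (∀ t ∈ Ioa' a, decRe a g t < ∞) ∧
    ∃ c > 0, ∫⁻ t in Ioa' a, ENNReal.ofReal (φs (c * (decRe a g t).toReal) * w t) < ∞}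

/-- The (generalized right-continuous) inverse `φ⁻¹(y) = inf{s ≥ 0 : φ(s) ≥ y}`. -/
def phiInv (φ : ℝ → ℝ) (y : ℝ) : ℝ := sInf {s : ℝ | 0 ≤ s ∧ y ≤ φ s}

theorem _root_.ConvexOn.slope_le_slope_of_le {s : Set ℝ} {f : ℝ → ℝ} (hf : ConvexOn ℝ s f)
    {p q r t : ℝ} (hp : p ∈ s) (hq : q ∈ s) (hr : r ∈ s) (ht : t ∈ s)
    (hpq : p < q) (hrt : r < t) (hpr : p ≤ r) (hqt : q ≤ t) :
    (f q - f p) / (q - p) ≤ (f t - f r) / (t - r) := by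
  have hpt : p < t := hpq.trans_le hqt
  have h := hf.secant_mono ht hp hr hpt.ne hrt.ne hpr
  rw [← neg_div_neg_eq (f p - f t), ← neg_div_neg_eq (f r - f t)] at h
  simp only [neg_sub] at h
  exact (hf.secant_mono hp hq ht hpq.ne' hpt.ne' hqt).trans h

/-- The perspective `(a, u) ↦ f (a / u) * u` of a convex function on `[0, ∞)` is submodular. -/
theorem _root_.ConvexOn.perspective_submodular {f : ℝ → ℝ} (hf : ConvexOn ℝ (Set.Ici 0) f)
    {a b u v : ℝ} (hb : 0 ≤ b) (hba : b ≤ a) (hv : 0 < v) (hvu : v ≤ u) :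
    f (a / u) * u + f (b / v) * v ≤ f (a / v) * v + f (b / u) * u := by
  rcases hba.eq_or_lt with rfl | hba
  · exact (add_comm _ _).le
  have hu : 0 < u := hv.trans_le hvu
  have ha : 0 ≤ a := hb.trans hba.le
  have h := hf.slope_le_slope_of_le (p := b / u) (q := a / u) (r := b / v) (t := a / v)
    (div_nonneg hb hu.le) (div_nonneg ha hu.le) (div_nonneg hb hv.le) (div_nonneg ha hv.le)
    (by gcongr) (by gcongr) (by gcongr) (by gcongr)
  rw [← sub_div, ← sub_div, div_div_eq_mul_div, div_div_eq_mul_div,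
    div_le_div_iff_of_pos_right (sub_pos.2 hba)] at h
  linarith

/-- If a cost matrix satisfies the Monge condition, the identity is an optimal assignment. -/
theorem sum_diag_le_sum_perm_of_monge {ι : Type*} [LinearOrder ι] {c : ι → ι → ℝ}
    (hc : ∀ i j k l, i ≤ j → k ≤ l → c i k + c j l ≤ c i l + c j k) (s : Finset ι)
    {σ : Equiv.Perm ι} (hσ : {i | σ i ≠ i} ⊆ s) :
    ∑ i ∈ s, c i i ≤ ∑ i ∈ s, c i (σ i) := by
  induction s using Finset.induction_on_max generalizing σ with
  | empty => simp
  | insert a s hmax ih =>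
    have has : a ∉ s := fun h => (hmax a h).false
    have mem_of_ne : ∀ {i}, σ i ≠ i → i ≠ a → i ∈ s := fun {i} h hia =>
      Finset.mem_of_mem_insert_of_ne (hσ h) hia
    rw [Finset.sum_insert has, Finset.sum_insert has]
    by_cases hσa : σ a = a
    · rw [hσa]
      exact add_le_add le_rfl (ih fun i hi => mem_of_ne hi fun h => hi (h ▸ hσa))
    set p := σ.symm a
    have hσp : σ p = a := σ.apply_symm_apply a
    have hpa : p ≠ a := fun h => hσa (h ▸ hσp)
    have hps : p ∈ s := mem_of_ne (hσp ▸ hpa.symm) hpa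
    have hqs : σ a ∈ s := mem_of_ne (σ.injective.ne hσa) hσa
    set τ : Equiv.Perm ι := σ.trans (Equiv.swap a (σ a)) with hτ
    have hτa : τ a = a := by simp [hτ]
    have hτp : τ p = σ a := by simp [hτ, hσp]
    have hτi : ∀ i, i ≠ a → i ≠ p → τ i = σ i := fun i hia hip =>
      Equiv.swap_apply_of_ne_of_ne (fun h => hip (σ.injective (h.trans hσp.symm)))
        (σ.injective.ne hia)
    have hsub : {i | τ i ≠ i} ⊆ (s : Set ι) := by
      intro i hi
      have hia : i ≠ a := fun h => hi (h ▸ hτa)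
      by_cases hip : i = p
      · exact hip ▸ hps
      · exact mem_of_ne (hτi i hia hip ▸ hi) hia
    have h := ih hsub
    have hcongr : ∑ i ∈ s.erase p, c i (τ i) = ∑ i ∈ s.erase p, c i (σ i) :=
      Finset.sum_congr rfl fun i hi => by
        rw [hτi i (hmax i (Finset.mem_of_mem_erase hi)).ne (Finset.ne_of_mem_erase hi)]
    rw [← Finset.add_sum_erase s (fun i => c i (τ i)) hps, hcongr] at h
    rw [← Finset.add_sum_erase s (fun i => c i (σ i)) hps]
    have hmonge := hc p a (σ a) a (hmax p hps).le (hmax _ hqs).le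
    simp only [hτp, hσp] at h ⊢
    linarith

/-- for a finite positive decreasing weight `w` and any finite sequence `x`
with decreasing rearrangement `xs`, the sum `∑ φ(x*(i)/w(i))·w(i)` equals the infimum of
`∑ φ(x*(i)/w(σ(i)))·w(σ(i))` over all permutations `σ`; in particular the identity
permutation attains the infimum. -/
theorem statement0 (φ : ℝ → ℝ) (hφ : IsOrliczFn φ) (n : ℕ)
    (w x xs : Fin n → ℝ)
    (hw_pos : ∀ i, 0 < w i)
    (hw_dec : ∀ i j : Fin n, i ≤ j → w j ≤ w i)
    (hxs_dec : ∀ i j : Fin n, i ≤ j → xs j ≤ xs i)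
    (hxs_perm : ∃ π : Equiv.Perm (Fin n), ∀ i, xs i = |x (π i)|) :
    (∑ i, φ (xs i / w i) * w i =
        ⨅ σ : Equiv.Perm (Fin n), ∑ i, φ (xs i / w (σ i)) * w (σ i)) ∧
      ∀ σ : Equiv.Perm (Fin n),
        ∑ i, φ (xs i / w i) * w i ≤ ∑ i, φ (xs i / w (σ i)) * w (σ i) := by
  have hxs_nonneg : ∀ i, 0 ≤ xs i := by
    obtain ⟨π, hπ⟩ := hxs_perm
    exact fun i => hπ i ▸ abs_nonneg _
  have hle : ∀ σ : Equiv.Perm (Fin n),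
      ∑ i, φ (xs i / w i) * w i ≤ ∑ i, φ (xs i / w (σ i)) * w (σ i) := fun σ =>
    sum_diag_le_sum_perm_of_monge (c := fun i k => φ (xs i / w k) * w k)
      (fun i j k l hij hkl => hφ.1.perspective_submodular (hxs_nonneg j) (hxs_dec i j hij)
        (hw_pos l) (hw_dec k l hkl))
      Finset.univ (by simp)
  exact ⟨le_antisymm (le_ciInf hle)
    (ciInf_le (Set.finite_range _).bddBelow (1 : Equiv.Perm (Fin n))), hle⟩

end OrliczRearrangement

end
end

section
/- Let φ be an Orlicz function, let w(1) ≥ … ≥ w(n) > 0 be a finite decreasing positive weight sequence, and let (a_{ij}) be an n×n matrix of non-negative real numbers such that for every i = 1,…,n the i-th row sum equals the i-th column sum, i.e. ∑_{j=1}^n a_{ij} = ∑_{j=1}^n a_{ji}. Then for every finite sequence of real numbers (x(1),…,x(n)) with decreasing rearrangement x*, ∑_{i,j=1}^n φ(x*(i)/w(i)) w(i) a_{ij} ≤ ∑_{i,j=1}^n φ(x*(i)/w(j)) w(j) a_{ij}. -/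
open MeasureTheory Set Filter Topology ENNReal

noncomputable section

namespace OrliczRearrangement

/-- The perspective `(t, v) ↦ φ (t / v) * v` of a convex function has decreasing differences. -/
lemma perspective_decreasing_differences {φ : ℝ → ℝ} (hφ : ConvexOn ℝ (Set.Ici 0) φ)
    {x y u v : ℝ} (hy : 0 ≤ y) (hyx : y ≤ x) (hv : 0 < v) (hvu : v ≤ u) :
    φ (x / u) * u - φ (y / u) * u ≤ φ (x / v) * v - φ (y / v) * v := by
  rcases hyx.eq_or_lt with rfl | hlt
  · simp
  have hu : 0 < u := hv.trans_le hvu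
  have hx : 0 ≤ x := hy.trans hyx
  have hxu : y / u < x / u := by gcongr
  have hxv : y / v < x / v := by gcongr
  have hxuv : x / u ≤ x / v := by gcongr
  have hyuv : y / u ≤ y / v := by gcongr
  have m {a b : ℝ} (ha : 0 ≤ a) (hb : 0 < b) : a / b ∈ Set.Ici (0 : ℝ) := div_nonneg ha hb.le
  have h₁ := hφ.secant_mono (m hy hu) (m hx hu) (m hx hv) hxu.ne' (hxu.trans_le hxuv).ne' hxuv
  have h₂ := hφ.secant_mono (m hx hv) (m hy hu) (m hy hv) (hxu.trans_le hxuv).ne hxv.ne hyuv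
  rw [← neg_div_neg_eq (φ (y / u) - _), neg_sub, neg_sub,
    ← neg_div_neg_eq (φ (y / v) - _), neg_sub, neg_sub] at h₂
  have h := h₁.trans h₂
  rw [← sub_div, ← sub_div, div_div_eq_mul_div, div_div_eq_mul_div,
    div_le_div_iff_of_pos_right (sub_pos.2 hlt)] at h
  linarith

/-- For a kernel with `F i l - F i (l + 1)` decreasing in `i` there are potentials certifying that
no cyclic reassignment of columns lowers the diagonal sum. -/
lemma exists_potential (F : ℕ → ℕ → ℝ)
    (hF : ∀ i k l, i ≤ k → F k (l + 1) - F k l ≤ F i (l + 1) - F i l) :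
    ∃ p : ℕ → ℝ, ∀ i j, p j - p i ≤ F i j - F i i := by
  refine ⟨fun k => ∑ l ∈ Finset.range k, (F l (l + 1) - F l l), fun i j => ?_⟩
  rcases le_total i j with h | h
  · induction j, h using Nat.le_induction with
    | base => simp
    | succ j hij ih =>
      have := hF i j j hij
      simp only [Finset.sum_range_succ] at ih ⊢
      linarith
  · rw [← neg_le_neg_iff, neg_sub, neg_sub, ← Finset.sum_Ico_sub (F i) h]
    beta_reduce
    rw [← Finset.sum_Ico_eq_sub _ h]
    exact Finset.sum_le_sum fun l hl => hF l i l (Finset.mem_Ico.1 hl).2.le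

/-- if the `i`-th row sum of the nonnegative matrix `A` equals its `i`-th
column sum for every `i`, then
`∑_{i,j} φ(x*(i)/w(i))·w(i)·A i j ≤ ∑_{i,j} φ(x*(i)/w(j))·w(j)·A i j`. -/
theorem statement1 (φ : ℝ → ℝ) (hφ : IsOrliczFn φ) (n : ℕ)
    (w x xs : Fin n → ℝ) (A : Fin n → Fin n → ℝ)
    (hw_pos : ∀ i, 0 < w i)
    (hw_dec : ∀ i j : Fin n, i ≤ j → w j ≤ w i)
    (hA_nonneg : ∀ i j, 0 ≤ A i j)
    (hA_sums : ∀ i, ∑ j, A i j = ∑ j, A j i)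
    (hxs_dec : ∀ i j : Fin n, i ≤ j → xs j ≤ xs i)
    (hxs_perm : ∃ π : Equiv.Perm (Fin n), ∀ i, xs i = |x (π i)|) :
    ∑ i, ∑ j, φ (xs i / w i) * w i * A i j ≤
      ∑ i, ∑ j, φ (xs i / w j) * w j * A i j := by
  rcases n with _ | m
  · simp
  let c : ℕ → Fin (m + 1) := fun k => ⟨min k m, by omega⟩
  have hc : Monotone c := fun a b h => Fin.mk_le_mk.2 (min_le_min_right m h)
  have hcv (i : Fin (m + 1)) : c i = i := Fin.ext (min_eq_left (Nat.lt_succ_iff.1 i.2))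
  have hxs (i) : 0 ≤ xs i := by
    obtain ⟨π, hπ⟩ := hxs_perm
    exact hπ i ▸ abs_nonneg _
  obtain ⟨p, hp⟩ := exists_potential (fun i j => φ (xs (c i) / w (c j)) * w (c j))
    fun i k l hik => by
      have := perspective_decreasing_differences hφ.1 (hxs (c k)) (hxs_dec _ _ (hc hik))
        (hw_pos (c (l + 1))) (hw_dec _ _ (hc l.le_succ))
      linarith
  have hsum : ∑ i : Fin (m + 1), ∑ j : Fin (m + 1), (p j - p i) * A i j = 0 := by
    simp only [sub_mul, Finset.sum_sub_distrib]
    rw [Finset.sum_comm]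
    simp only [← Finset.mul_sum, hA_sums, sub_self]
  rw [← sub_nonneg, ← Finset.sum_sub_distrib, ← hsum]
  refine Finset.sum_le_sum fun i _ => ?_
  rw [← Finset.sum_sub_distrib]
  refine Finset.sum_le_sum fun j _ => ?_
  rw [← sub_mul]
  have := hp i j
  simp only [hcv] at this
  exact mul_le_mul_of_nonneg_right this (hA_nonneg i j)

end OrliczRearrangement

end
end

section
/- Let φ be an Orlicz function and w = (w(n)) a decreasing non-negative weight sequence. Then for every real sequence x = (x(n)), ∑_{n=1}^∞ φ(x*(n)/w(n)) w(n) = inf { ∑_{n=1}^∞ φ(|x(n)|/v(n)) v(n) : v ≥ 0, v* = w }, where the infimum is over all non-negative sequences v whose decreasing rearrangement equals w. -/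
open MeasureTheory Set Filter Topology ENNReal

noncomputable section

namespace OrliczRearrangement

section OTerm

variable {φ : ℝ → ℝ}

lemma IsOrliczFn.nonneg (hφ : IsOrliczFn φ) {t : ℝ} (ht : 0 ≤ t) : 0 ≤ φ t := by
  have h := hφ.2.1.monotoneOn (Set.self_mem_Ici : (0 : ℝ) ∈ Set.Ici 0) ht ht
  rwa [hφ.2.2] at h

lemma oterm_zero_left (hφ : IsOrliczFn φ) (v : ℝ) : oterm φ 0 v = 0 := by
  simp [oterm, hφ.2.2]

lemma oterm_mono_left (hφ : IsOrliczFn φ) {c d v : ℝ} (hc : 0 ≤ c) (hcd : c ≤ d)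
    (hv : 0 ≤ v) : oterm φ c v ≤ oterm φ d v := by
  unfold oterm
  split_ifs with h1 h2 h3 h3
  · exact le_rfl
  · exact zero_le
  · exact absurd (le_antisymm (h3 ▸ hcd) hc) h2
  · exact le_rfl
  · refine ENNReal.ofReal_le_ofReal (mul_le_mul_of_nonneg_right ?_ hv)
    exact hφ.2.1.monotoneOn (div_nonneg hc hv) (div_nonneg (hc.trans hcd) hv)
      (div_le_div_of_nonneg_right hcd hv)

/-- The perspective of a convex function satisfies a four-point inequality. -/
lemma ConvexOn.perspective_four_point (hφ : ConvexOn ℝ (Set.Ici 0) φ) {c d v u : ℝ}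
    (hd : 0 ≤ d) (hdc : d ≤ c) (hu : 0 < u) (huv : u ≤ v) :
    φ (c / v) * v + φ (d / u) * u ≤ φ (c / u) * u + φ (d / v) * v := by
  have hv : 0 < v := hu.trans_le huv
  have hp : 0 ≤ d / v := div_nonneg hd hv.le
  have hq : 0 ≤ c / u := div_nonneg (hd.trans hdc) hu.le
  have hD : 0 ≤ c * v - d * u := by nlinarith
  rcases hD.eq_or_lt with hD | hD
  · rcases hdc.eq_or_lt with rfl | hlt
    · linarith
    · have : c * (v - u) + (c - d) * u = 0 := by linarith
      have h1 : 0 ≤ c * (v - u) := mul_nonneg (hd.trans hdc) (by linarith)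
      have h2 : 0 < (c - d) * u := mul_pos (by linarith) hu
      linarith
  · have key : ∀ a : ℝ, 0 ≤ a → a ≤ 1 →
        φ ((1 - a) * (d / v) + a * (c / u)) ≤ (1 - a) * φ (d / v) + a * φ (c / u) := by
      intro a ha0 ha1
      exact hφ.2 hp hq (by linarith) ha0 (by ring)
    have h1 := key ((c - d) * u / (c * v - d * u))
      (div_nonneg (mul_nonneg (by linarith) hu.le) hD.le)
      ((div_le_one hD).2 (by nlinarith))
    have h2 := key (d * (v - u) / (c * v - d * u))
      (div_nonneg (mul_nonneg hd (by linarith)) hD.le)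
      ((div_le_one hD).2 (by nlinarith))
    have hD' := hD.ne'
    have e1 : (1 - (c - d) * u / (c * v - d * u)) * (d / v)
        + (c - d) * u / (c * v - d * u) * (c / u) = c / v := by
      field_simp
      ring
    have e2 : (1 - d * (v - u) / (c * v - d * u)) * (d / v)
        + d * (v - u) / (c * v - d * u) * (c / u) = d / u := by
      have hb := div_mul_cancel₀ (d * (v - u)) hD'
      generalize d * (v - u) / (c * v - d * u) = b at hb
      field_simp
      linear_combination hb
    rw [e1] at h1
    rw [e2] at h2
    have h3 := mul_le_mul_of_nonneg_right h1 hv.le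
    have h4 := mul_le_mul_of_nonneg_right h2 hu.le
    refine (add_le_add h3 h4).trans (le_of_eq ?_)
    field_simp
    ring

lemma oterm_four_point (hφ : IsOrliczFn φ) {c d v u : ℝ}
    (hd : 0 ≤ d) (hdc : d ≤ c) (hu : 0 ≤ u) (huv : u ≤ v) :
    oterm φ c v + oterm φ d u ≤ oterm φ c u + oterm φ d v := by
  have hc := hd.trans hdc
  rcases hu.eq_or_lt with rfl | hu
  · rcases hc.eq_or_lt with rfl | hc
    · simp [oterm_zero_left hφ, le_antisymm hdc hd]
    · simp [oterm, hc.ne']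
  · have hv := hu.trans_le huv
    have hn : ∀ {a b : ℝ}, 0 ≤ a → 0 < b → 0 ≤ φ (a / b) * b := fun ha hb =>
      mul_nonneg (hφ.nonneg (div_nonneg ha hb.le)) hb.le
    simp only [oterm, hu.ne', hv.ne', if_false]
    rw [← ENNReal.ofReal_add (hn hc hv) (hn hd hu), ← ENNReal.ofReal_add (hn hc hu) (hn hd hv)]
    exact ENNReal.ofReal_le_ofReal (ConvexOn.perspective_four_point hφ.1 hd hdc hu huv)

lemma oterm_anti_right (hφ : IsOrliczFn φ) {c v u : ℝ} (hc : 0 ≤ c) (hu : 0 ≤ u)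
    (huv : u ≤ v) : oterm φ c v ≤ oterm φ c u := by
  simpa [oterm_zero_left hφ] using oterm_four_point hφ le_rfl hc hu huv

lemma oterm_pos (hφ : IsOrliczFn φ) {c v : ℝ} (hc : 0 < c) (hv : 0 ≤ v) :
    0 < oterm φ c v := by
  unfold oterm
  split_ifs with h1 h2
  · exact absurd h2 hc.ne'
  · simp
  · have hv := lt_of_le_of_ne hv (Ne.symm h1)
    have hcv : 0 < c / v := div_pos hc hv
    have h := hφ.2.1 (Set.self_mem_Ici : (0 : ℝ) ∈ Set.Ici 0) hcv.le hcv
    rw [hφ.2.2] at h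
    exact ENNReal.ofReal_pos.2 (mul_pos h hv)

/-- A Hardy–Littlewood type rearrangement inequality for `oterm`. -/
lemma sum_oterm_le_sum_oterm_comp (hφ : IsOrliczFn φ) {c w v : ℕ → ℝ} (hc0 : ∀ n, 0 ≤ c n)
    (hc : Antitone c) (hv0 : ∀ n, 0 ≤ v n) (hv : ∀ j : ℕ, sdistr v (w j) ≤ j)
    (N : ℕ) (π : ℕ → ℕ) (hπ : Function.Injective π) :
    ∑ i ∈ Finset.range N, oterm φ (c i) (w i) ≤
      ∑ i ∈ Finset.range N, oterm φ (c i) (v (π i)) := by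
  induction N generalizing π with
  | zero => simp
  | succ N ih =>
    obtain ⟨m, hm, hmin⟩ := (Finset.range (N + 1)).exists_min_image (fun i => v (π i)) ⟨0, by simp⟩
    have hmw : v (π m) ≤ w N := by
      by_contra! hlt
      have hsub : (((Finset.range (N + 1)).image π : Finset ℕ) : Set ℕ) ⊆
          {k | w N < |v k|} := by
        intro k hk
        obtain ⟨i, hi, rfl⟩ := Finset.mem_image.1 (Finset.mem_coe.1 hk)
        exact (hlt.trans_le (hmin i hi)).trans_le (le_abs_self _)
      have h := (Set.encard_le_encard hsub).trans (hv N)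
      rw [Set.encard_coe_eq_coe_finsetCard, Finset.card_image_of_injective _ hπ,
        Finset.card_range] at h
      have : N + 1 ≤ N := by exact_mod_cast h
      omega
    have hswap : ∑ i ∈ Finset.range (N + 1), oterm φ (c i) (v (π (Equiv.swap m N i))) ≤
        ∑ i ∈ Finset.range (N + 1), oterm φ (c i) (v (π i)) := by
      rcases eq_or_ne m N with rfl | hne
      · simp
      have hmN : m ∈ Finset.range N := by
        have := Finset.mem_range.1 hm
        exact Finset.mem_range.2 (by omega)
      rw [Finset.sum_range_succ, Finset.sum_range_succ, ← Finset.add_sum_erase _ _ hmN,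
        ← Finset.add_sum_erase _ _ hmN]
      have hrest : ∑ i ∈ (Finset.range N).erase m, oterm φ (c i) (v (π (Equiv.swap m N i))) =
          ∑ i ∈ (Finset.range N).erase m, oterm φ (c i) (v (π i)) := by
        refine Finset.sum_congr rfl fun i hi => ?_
        obtain ⟨h1, h2⟩ := Finset.mem_erase.1 hi
        rw [Equiv.swap_apply_of_ne_of_ne h1 (Finset.mem_range.1 h2).ne]
      rw [hrest, Equiv.swap_apply_left, Equiv.swap_apply_right, add_right_comm,
        add_right_comm (oterm φ (c m) (v (π m)))]
      gcongr ?_ + _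
      exact oterm_four_point hφ (hc0 N) (hc (Finset.mem_range.1 hmN).le) (hv0 _)
        (hmin N (by simp))
    refine le_trans ?_ hswap
    rw [Finset.sum_range_succ, Finset.sum_range_succ, Equiv.swap_apply_right]
    exact add_le_add (ih (fun i => π (Equiv.swap m N i)) (hπ.comp (Equiv.injective _)))
      (oterm_anti_right hφ (hc0 N) (hv0 _) hmw)

end OTerm

/-- The infimum defining the decreasing rearrangement is attained. -/
lemma sdistr_le_of_sdecRe_le {v : ℕ → ℝ} {n : ℕ} {a : ℝ} (ha : 0 ≤ a)
    (h : sdecRe v n ≤ ENNReal.ofReal a) : sdistr v a ≤ n := by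
  by_contra! hlt
  obtain ⟨t, ht, htc⟩ := Set.exists_subset_encard_eq (Order.add_one_le_of_lt hlt)
  have htf : t.Finite := Set.finite_of_encard_eq_coe (k := n + 1) (by exact_mod_cast htc)
  have htn : t.Nonempty := by
    rw [← Set.encard_pos, htc]
    simp
  obtain ⟨m, hm, hmin⟩ := Set.exists_min_image t (fun k => |v k|) htf htn
  have ham : a < |v m| := ht hm
  have hle : ENNReal.ofReal |v m| ≤ sdecRe v n := by
    refine le_sInf ?_
    rintro _ ⟨s, ⟨-, hs⟩, rfl⟩
    refine ENNReal.ofReal_le_ofReal ?_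
    by_contra! hsm
    have hsub : t ⊆ {k | s < |v k|} := fun k hk => hsm.trans_le (hmin k hk)
    have h2 := (Set.encard_le_encard hsub).trans hs
    rw [htc] at h2
    have : n + 1 ≤ n := by exact_mod_cast h2
    omega
  exact absurd ((ENNReal.ofReal_le_ofReal_iff ha).1 (hle.trans h)) (not_le.2 ham)

lemma le_sdecRe_of_infinite {x : ℕ → ℝ} {ε : ℝ} (h : {k | ε < |x k|}.Infinite) (n : ℕ) :
    ENNReal.ofReal ε ≤ sdecRe x n := by
  refine le_sInf ?_
  rintro _ ⟨s, ⟨-, hs⟩, rfl⟩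
  refine ENNReal.ofReal_le_ofReal ?_
  by_contra! hlt
  refine h ((Set.finite_of_encard_le_coe hs).subset fun k hk => ?_)
  exact hlt.trans hk

lemma sdecRe_eq_of_antitone_comp {y : ℕ → ℝ} {π : ℕ → ℕ} (hπ : Function.Injective π)
    (hy : Antitone fun n => |y (π n)|) (hoff : ∀ k ∉ Set.range π, y k = 0) (n : ℕ) :
    sdecRe y n = ENNReal.ofReal |y (π n)| := by
  apply le_antisymm
  · have hmem : ∀ s : ℝ, 0 < s → |y (π n)| ≤ s → sdecRe y n ≤ ENNReal.ofReal s := by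
      intro s hs0 hs
      refine sInf_le ⟨s, ⟨hs0, ?_⟩, rfl⟩
      have hsub : {k | s < |y k|} ⊆ (((Finset.range n).image π : Finset ℕ) : Set ℕ) := by
        intro k hk
        have hk : s < |y k| := hk
        have hr : k ∈ Set.range π := by
          by_contra hr
          rw [hoff k hr, abs_zero] at hk
          exact absurd hk (not_lt.2 hs0.le)
        obtain ⟨i, rfl⟩ := hr
        refine Finset.mem_coe.2 (Finset.mem_image_of_mem _ (Finset.mem_range.2 ?_))
        by_contra! hni
        exact absurd (hk.trans_le ((hy hni).trans hs)) (lt_irrefl _)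
      refine (Set.encard_le_encard hsub).trans ?_
      rw [Set.encard_coe_eq_coe_finsetCard, Finset.card_image_of_injective _ hπ,
        Finset.card_range]
    refine ENNReal.le_of_forall_pos_le_add fun ε hε _ => ?_
    rw [← ENNReal.ofReal_coe_nnreal, ← ENNReal.ofReal_add (abs_nonneg (y (π n))) ε.coe_nonneg]
    exact hmem _ (add_pos_of_nonneg_of_pos (abs_nonneg _) hε) (le_add_of_nonneg_right ε.coe_nonneg)
  · refine le_sInf ?_
    rintro _ ⟨s, ⟨-, hs⟩, rfl⟩
    refine ENNReal.ofReal_le_ofReal ?_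
    by_contra! hlt
    have hsub : (((Finset.range (n + 1)).image π : Finset ℕ) : Set ℕ) ⊆ {k | s < |y k|} := by
      intro k hk
      obtain ⟨i, hi, rfl⟩ := Finset.mem_image.1 (Finset.mem_coe.1 hk)
      exact hlt.trans_le (hy (Nat.lt_succ_iff.1 (Finset.mem_range.1 hi)))
    have h2 := (Set.encard_le_encard hsub).trans hs
    rw [Set.encard_coe_eq_coe_finsetCard, Finset.card_image_of_injective _ hπ,
      Finset.card_range] at h2
    have : n + 1 ≤ n := by exact_mod_cast h2
    omega

/-- A null sequence can be enumerated in decreasing order of absolute value, up to zero entries. -/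
lemma exists_injective_antitone_comp {x : ℕ → ℝ}
    (hx : ∀ ε : ℝ, 0 < ε → {k | ε < |x k|}.Finite) :
    ∃ π : ℕ → ℕ, Function.Injective π ∧ Antitone (fun n => |x (π n)|) ∧
      ∀ k ∉ Set.range π, x k = 0 := by
  have hmax : ∀ s : Finset ℕ, ∃ m, m ∉ s ∧ ∀ k ∉ s, |x k| ≤ |x m| := by
    intro s
    by_cases h : ∃ k₀, k₀ ∉ s ∧ x k₀ ≠ 0
    · obtain ⟨k₀, hk₀, hne⟩ := h
      have hpos : 0 < |x k₀| := abs_pos.2 hne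
      have hfin : {k | k ∉ s ∧ |x k₀| ≤ |x k|}.Finite :=
        (hx (|x k₀| / 2) (by linarith)).subset fun k hk => by
          have := hk.2
          show |x k₀| / 2 < |x k|
          linarith
      obtain ⟨m, hm, hmm⟩ := Set.exists_max_image _ (fun k => |x k|) hfin ⟨k₀, hk₀, le_rfl⟩
      refine ⟨m, hm.1, fun k hk => ?_⟩
      by_cases hk' : |x k₀| ≤ |x k|
      · exact hmm k ⟨hk, hk'⟩
      · exact (not_le.1 hk').le.trans hm.2
    · push Not at h
      obtain ⟨m, hm⟩ := Infinite.exists_notMem_finset s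
      exact ⟨m, hm, fun k hk => by simp [h k hk]⟩
  choose f hf hfm using hmax
  let S : ℕ → Finset ℕ := fun n => Nat.rec ∅ (fun _ s => insert (f s) s) n
  have hS : ∀ n, S (n + 1) = insert (f (S n)) (S n) := fun _ => rfl
  have hmono : Monotone S := monotone_nat_of_le_succ fun n => by
    rw [hS]
    exact Finset.subset_insert _ _
  have hmem : ∀ m n, m < n → f (S m) ∈ S n := fun m n hmn =>
    hmono (Nat.succ_le_of_lt hmn) (by rw [Nat.succ_eq_add_one, hS]; exact Finset.mem_insert_self _ _)
  have hinj : Function.Injective fun n => f (S n) := by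
    refine Function.Injective.of_lt_imp_ne fun m n hmn heq => hf (S n) ?_
    have heq : f (S m) = f (S n) := heq
    exact heq ▸ hmem m n hmn
  refine ⟨fun n => f (S n), hinj, antitone_nat_of_succ_le fun n => ?_, fun k hk => ?_⟩
  · exact hfm _ _ fun h => hf (S (n + 1)) (hmono n.le_succ h)
  · have hkS : ∀ n, k ∉ S n := by
      intro n
      induction n with
      | zero => exact Finset.notMem_empty k
      | succ n ih =>
        rw [hS, Finset.mem_insert, not_or]
        exact ⟨fun h => hk ⟨n, h.symm⟩, ih⟩
    by_contra hne
    have hpos : 0 < |x k| := abs_pos.2 hne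
    refine Set.infinite_range_of_injective hinj ((hx (|x k| / 2) (by linarith)).subset ?_)
    rintro _ ⟨n, rfl⟩
    have := hfm _ _ (hkS n)
    show |x k| / 2 < |x (f (S n))|
    linarith

/-- for a decreasing nonnegative weight sequence `w` and any real sequence
`x`, `∑ φ(x*(n)/w(n))·w(n) = inf{∑ φ(|x(n)|/v(n))·v(n) : v ≥ 0, v* = w}`. -/
theorem statement2 (φ : ℝ → ℝ) (hφ : IsOrliczFn φ)
    (w : ℕ → ℝ) (hw_nonneg : ∀ n, 0 ≤ w n)
    (hw_dec : ∀ m n : ℕ, m ≤ n → w n ≤ w m)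
    (x : ℕ → ℝ) :
    ∑' n, otermE φ (sdecRe x n) (w n) =
      ⨅ v ∈ {v : ℕ → ℝ | (∀ n, 0 ≤ v n) ∧ ∀ n, sdecRe v n = ENNReal.ofReal (w n)},
        ∑' n, oterm φ |x n| (v n) := by
  have hanti : Antitone w := fun m n h => hw_dec m n h
  by_cases hx : ∀ ε : ℝ, 0 < ε → {k | ε < |x k|}.Finite
  · obtain ⟨π, hπ, hxπ, hoff⟩ := exists_injective_antitone_comp hx
    have hterm : ∀ n, otermE φ (sdecRe x n) (w n) = oterm φ |x (π n)| (w n) := by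
      intro n
      rw [sdecRe_eq_of_antitone_comp hπ hxπ hoff, otermE, if_neg ENNReal.ofReal_ne_top,
        ENNReal.toReal_ofReal (abs_nonneg _)]
    simp_rw [hterm]
    apply le_antisymm
    · refine le_iInf₂ fun v hv => ?_
      have hd : ∀ j : ℕ, sdistr v (w j) ≤ j := fun j =>
        sdistr_le_of_sdecRe_le (hw_nonneg j) (hv.2 j).le
      refine le_trans ?_ (ENNReal.tsum_comp_le_tsum_of_injective hπ fun n => oterm φ |x n| (v n))
      refine ENNReal.tsum_le_of_sum_range_le fun N => ?_
      exact (sum_oterm_le_sum_oterm_comp hφ (fun _ => abs_nonneg _) hxπ hv.1 hd N π hπ).trans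
        (ENNReal.sum_le_tsum _)
    · have hvπ : ∀ n, Function.extend π w 0 (π n) = w n := fun n => hπ.extend_apply w 0 n
      have hv0 : ∀ k ∉ Set.range π, Function.extend π w 0 k = 0 := fun k hk =>
        Function.extend_apply' _ _ _ hk
      refine iInf₂_le_of_le (Function.extend π w 0) ⟨fun k => ?_, fun n => ?_⟩ ?_
      · by_cases hk : k ∈ Set.range π
        · obtain ⟨n, rfl⟩ := hk
          rw [hvπ]
          exact hw_nonneg n
        · rw [hv0 k hk]
      · rw [sdecRe_eq_of_antitone_comp hπ ?_ hv0, hvπ, abs_of_nonneg (hw_nonneg n)]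
        simpa only [hvπ, abs_of_nonneg (hw_nonneg _)] using hanti
      · rw [← hπ.tsum_eq (f := fun n => oterm φ |x n| (Function.extend π w 0 n))]
        · simp_rw [hvπ]
          exact le_rfl
        · intro k hk
          by_contra hr
          exact hk (by simp [hoff k hr, oterm_zero_left hφ])
  · push Not at hx
    obtain ⟨ε, hε, hinf⟩ := hx
    have hpos : oterm φ ε (w 0) ≠ 0 := (oterm_pos hφ hε (hw_nonneg 0)).ne'
    have hleft : ∑' n, otermE φ (sdecRe x n) (w n) = ∞ := by
      rw [eq_top_iff, ← ENNReal.tsum_const_eq_top_of_ne_zero (α := ℕ) hpos]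
      refine ENNReal.tsum_le_tsum fun n => ?_
      unfold otermE
      split_ifs with h
      · exact le_top
      · refine (oterm_anti_right hφ hε.le (hw_nonneg n) (hanti n.zero_le)).trans
          (oterm_mono_left hφ hε.le ?_ (hw_nonneg n))
        exact (ENNReal.ofReal_le_iff_le_toReal h).1 (le_sdecRe_of_infinite hinf n)
    rw [hleft, eq_comm, iInf₂_eq_top]
    intro v hv
    have hle : ∀ k, v k ≤ w 0 := by
      intro k
      have h := sdistr_le_of_sdecRe_le (hw_nonneg 0) (hv.2 0).le
      rw [Nat.cast_zero, nonpos_iff_eq_zero, sdistr, Set.encard_eq_zero] at h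
      by_contra! hlt
      exact Set.eq_empty_iff_forall_notMem.1 h k (hlt.trans_le (le_abs_self _))
    have : Infinite {k | ε < |x k|} := Set.infinite_coe_iff.2 hinf
    rw [eq_top_iff, ← ENNReal.tsum_const_eq_top_of_ne_zero (α := {k | ε < |x k|}) hpos]
    refine le_trans (ENNReal.tsum_le_tsum fun k => ?_)
      (ENNReal.tsum_comp_le_tsum_of_injective Subtype.val_injective fun n => oterm φ |x n| (v n))
    exact (oterm_anti_right hφ hε.le (hv.1 k) (hle k)).trans
      (oterm_mono_left hφ hε.le k.2.le (hv.1 k))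

end OrliczRearrangement

end
end

section
/- Let φ be an Orlicz function and w = (w(n)) a positive decreasing weight sequence which is φ-controlled, i.e. there exists K > 0 such that φ(c/w(2n)) w(2n) ≤ K φ(c/w(n)) w(n) for every c > 0 and n ∈ ℕ. Then for every real sequence x = (x(n)), ∑_{n=1}^∞ φ(x*(n)/w(n)) w(n) = inf { ∑_{n=1}^∞ φ(|x(n)|/v(n)) v(n) : v > 0, v* = w } = inf { ∑_{n=1}^∞ φ(|x(n)|/w(σ(n))) w(σ(n)) : σ a bijection of ℕ }. -/
open MeasureTheory Set Filter Topology ENNReal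

noncomputable section

namespace OrliczRearrangement

section Perspective

variable {φ : ℝ → ℝ}

lemma IsOrliczFn.perspective_nonneg (hφ : IsOrliczFn φ) {c v : ℝ} (hc : 0 ≤ c) (hv : 0 < v) :
    0 ≤ φ (c / v) * v :=
  mul_nonneg (hφ.nonneg (by positivity)) hv.le

lemma IsOrliczFn.perspective_mono (hφ : IsOrliczFn φ) {c c' v : ℝ} (hc : 0 ≤ c) (h : c ≤ c')
    (hv : 0 < v) : φ (c / v) * v ≤ φ (c' / v) * v := by
  have hc' : 0 ≤ c' := hc.trans h
  refine mul_le_mul_of_nonneg_right (hφ.2.1.monotoneOn ?_ ?_ ?_) hv.le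
  · exact Set.mem_Ici.2 (by positivity)
  · exact Set.mem_Ici.2 (by positivity)
  · gcongr

lemma IsOrliczFn.perspective_anti (hφ : IsOrliczFn φ) {c v v' : ℝ} (hc : 0 ≤ c) (hv : 0 < v)
    (h : v ≤ v') : φ (c / v') * v' ≤ φ (c / v) * v := by
  have hv' : 0 < v' := hv.trans_le h
  have key := hφ.1.2 (Set.mem_Ici.2 (by positivity : 0 ≤ c / v)) (Set.mem_Ici.2 le_rfl)
    (by positivity : 0 ≤ v / v') (sub_nonneg.2 ((div_le_one hv').2 h)) (by ring)
  have e : (v / v') • (c / v) + (1 - v / v') • (0 : ℝ) = c / v' := by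
    simp only [smul_eq_mul]; field_simp; ring
  rw [e, hφ.2.2] at key
  simp only [smul_eq_mul, mul_zero, add_zero] at key
  calc φ (c / v') * v' ≤ (v / v' * φ (c / v)) * v' := by gcongr
    _ = φ (c / v) * v := by field_simp

/-- The perspective `(c, v) ↦ φ (c / v) * v` of a convex function is submodular. -/
lemma IsOrliczFn.perspective_submodular (hφ : IsOrliczFn φ) {c c' v v' : ℝ} (hc' : 0 ≤ c')
    (hc : c' ≤ c) (hv' : 0 < v') (hv : v' ≤ v) :
    φ (c / v) * v + φ (c' / v') * v' ≤ φ (c / v') * v' + φ (c' / v) * v := by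
  have hvp : 0 < v := hv'.trans_le hv
  have hcp : 0 ≤ c := hc'.trans hc
  have hCA : c / v ≤ c / v' := by gcongr
  have hCB : c' / v' ≤ c / v' := by gcongr
  have hAD : c' / v ≤ c / v := by gcongr
  have hBD : c' / v ≤ c' / v' := by gcongr
  have hD0 : 0 ≤ c' / v := by positivity
  have hC0 : 0 ≤ c / v' := by positivity
  have hsum : (c / v) * v + (c' / v') * v' = (c / v') * v' + (c' / v) * v := by field_simp
  generalize c / v = A at *
  generalize c' / v' = B at *
  generalize c / v' = C at *
  generalize c' / v = D at *
  rcases (hAD.trans hCA).eq_or_lt with h | h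
  · obtain rfl : A = D := by linarith
    obtain rfl : B = A := by linarith
    rw [← h]; linarith
  have hCD : 0 < C - D := sub_pos.2 h
  have chord : ∀ T, D ≤ T → T ≤ C → φ T * (C - D) ≤ (T - D) * φ C + (C - T) * φ D := by
    intro T h1 h2
    have key := hφ.1.2 (Set.mem_Ici.2 hC0) (Set.mem_Ici.2 hD0)
      (div_nonneg (sub_nonneg.2 h1) hCD.le) (div_nonneg (sub_nonneg.2 h2) hCD.le)
      (by field_simp; ring)
    have e : ((T - D) / (C - D)) • C + ((C - T) / (C - D)) • D = T := by
      simp only [smul_eq_mul]; field_simp; ring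
    rw [e] at key
    simp only [smul_eq_mul] at key
    calc φ T * (C - D) ≤ ((T - D) / (C - D) * φ C + (C - T) / (C - D) * φ D) * (C - D) := by
          gcongr
      _ = _ := by field_simp
  have hA := mul_le_mul_of_nonneg_right (chord A hAD hCA) hvp.le
  have hB := mul_le_mul_of_nonneg_right (chord B hBD hCB) hv'.le
  refine le_of_mul_le_mul_right ?_ hCD
  have e : (A - D) * v + (B - D) * v' = (C - D) * v' := by linarith
  have e' : (C - A) * v + (C - B) * v' = (C - D) * v := by linarith
  calc (φ A * v + φ B * v') * (C - D) = φ A * (C - D) * v + φ B * (C - D) * v' := by ring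
    _ ≤ ((A - D) * φ C + (C - A) * φ D) * v + ((B - D) * φ C + (C - B) * φ D) * v' :=
        add_le_add hA hB
    _ = ((A - D) * v + (B - D) * v') * φ C + ((C - A) * v + (C - B) * v') * φ D := by ring
    _ = (φ C * v' + φ D * v) * (C - D) := by rw [e, e']; ring

lemma oterm_of_pos {c v : ℝ} (hv : 0 < v) : oterm φ c v = ENNReal.ofReal (φ (c / v) * v) :=
  if_neg hv.ne'

lemma IsOrliczFn.oterm_zero (hφ : IsOrliczFn φ) {v : ℝ} (hv : 0 < v) : oterm φ 0 v = 0 := by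
  simp [oterm_of_pos hv, hφ.2.2]

end Perspective

section Rearrangement

lemma ofReal_le_sdecRe {y : ℕ → ℝ} {k : ℕ → ℕ} (hk : Function.Injective k) {n : ℕ} {m : ℝ}
    (h : ∀ j ≤ n, m ≤ |y (k j)|) : ENNReal.ofReal m ≤ sdecRe y n := by
  refine le_sInf ?_
  rintro _ ⟨s, ⟨-, hs⟩, rfl⟩
  refine ENNReal.ofReal_le_ofReal ?_
  by_contra! hsm
  have hsub : k '' Set.Iic n ⊆ {j | s < |y j|} := by
    rintro _ ⟨j, hj, rfl⟩
    exact hsm.trans_le (h j hj)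
  have h1 := (Set.encard_le_encard hsub).trans hs
  rw [hk.encard_image, ← Finset.coe_Iic, Set.encard_coe_eq_coe_finsetCard, Nat.card_Iic] at h1
  exact absurd (Nat.cast_le.1 h1) (by omega)

lemma sdecRe_eq {y : ℕ → ℝ} {k : ℕ → ℕ} (hk : Function.Injective k)
    (hanti : Antitone fun i => |y (k i)|) (hout : ∀ j ∉ Set.range k, ∀ i, |y j| ≤ |y (k i)|)
    (n : ℕ) : sdecRe y n = ENNReal.ofReal |y (k n)| := by
  refine le_antisymm ?_ (ofReal_le_sdecRe hk fun j hj => hanti hj)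
  refine ENNReal.le_of_forall_pos_le_add fun ε hε _ => ?_
  have hε' : (0 : ℝ) < ε := hε
  rw [← ENNReal.ofReal_coe_nnreal, ← ENNReal.ofReal_add (abs_nonneg _) hε'.le]
  refine sInf_le ⟨_, ⟨by positivity, ?_⟩, rfl⟩
  have hsub : {j | |y (k n)| + ε < |y j|} ⊆ k '' Set.Iio n := by
    intro j hj
    have hj : |y (k n)| + ε < |y j| := hj
    by_cases hr : j ∈ Set.range k
    · obtain ⟨i, rfl⟩ := hr
      refine ⟨i, ?_, rfl⟩
      by_contra hi
      have := hanti (not_lt.1 hi)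
      dsimp only at this
      linarith
    · linarith [hout j hr n]
  refine (Set.encard_le_encard hsub).trans ?_
  rw [hk.encard_image, ← Finset.coe_Iio, Set.encard_coe_eq_coe_finsetCard, Nat.card_Iio]

/-- A null sequence admits an injective enumeration of its entries by decreasing modulus which
exhausts the support. -/
lemma exists_antitone_enumeration {x : ℕ → ℝ} (hx : Tendsto x cofinite (𝓝 0)) :
    ∃ k : ℕ → ℕ, Function.Injective k ∧ (Antitone fun i => |x (k i)|) ∧
      ∀ j ∉ Set.range k, x j = 0 := by
  have hfin : ∀ δ > 0, {j | δ ≤ |x j|}.Finite := by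
    intro δ hδ
    have := hx.eventually (Metric.ball_mem_nhds 0 hδ)
    rw [Filter.eventually_cofinite] at this
    refine this.subset fun j hj => ?_
    simpa using hj
  have hmax : ∀ s : Finset ℕ, ∃ m ∉ s, ∀ j ∉ s, |x j| ≤ |x m| := by
    intro s
    by_cases h : ∃ m ∉ s, x m ≠ 0
    · obtain ⟨m₀, hm₀, hx₀⟩ := h
      obtain ⟨m, ⟨hms, hm⟩, hmm⟩ := Set.exists_max_image {j | j ∉ s ∧ |x m₀| ≤ |x j|}
        (fun j => |x j|) ((hfin _ (abs_pos.2 hx₀)).subset fun j hj => hj.2) ⟨m₀, hm₀, le_rfl⟩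
      refine ⟨m, hms, fun j hj => ?_⟩
      rcases le_total |x m₀| |x j| with h | h
      · exact hmm j ⟨hj, h⟩
      · exact h.trans hm
    · push Not at h
      obtain ⟨m, hm⟩ := Infinite.exists_notMem_finset s
      exact ⟨m, hm, fun j hj => by rw [h j hj, h m hm]⟩
  choose f hf hfmax using hmax
  let F : ℕ → Finset ℕ := fun n => Nat.rec ∅ (fun _ s => insert (f s) s) n
  have hFs : ∀ n, F (n + 1) = insert (f (F n)) (F n) := fun _ => rfl
  have hFmono : Monotone F := monotone_nat_of_le_succ fun n => by
    rw [hFs]; exact Finset.subset_insert _ _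
  have hmem : ∀ i n, i < n → f (F i) ∈ F n := fun i n h =>
    hFmono (Nat.succ_le_of_lt h) (by rw [Nat.succ_eq_add_one, hFs]; exact Finset.mem_insert_self _ _)
  have hFr : ∀ n, ∀ j ∈ F n, j ∈ Set.range fun n => f (F n) := by
    intro n
    induction n with
    | zero => intro j hj; exact absurd hj (Finset.notMem_empty j)
    | succ n ih =>
      intro j hj
      rw [hFs, Finset.mem_insert] at hj
      rcases hj with rfl | hj
      · exact ⟨n, rfl⟩
      · exact ih j hj
  have hinj : Function.Injective fun n => f (F n) := by
    intro i j hij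
    dsimp only at hij
    rcases lt_trichotomy i j with h | h | h
    · exact absurd (hij ▸ hmem i j h) (hf _)
    · exact h
    · exact absurd (hij ▸ hmem j i h) (hf _)
  refine ⟨fun n => f (F n), hinj, antitone_nat_of_succ_le fun n => ?_, fun j hj => ?_⟩
  · exact hfmax _ _ fun h => hf _ (hFmono n.le_succ h)
  · have hle : ∀ n, |x j| ≤ |x (f (F n))| := fun n => hfmax _ _ fun h => hj (hFr n j h)
    have hlim : Tendsto (fun n => |x (f (F n))|) atTop (𝓝 0) := by
      have := (hx.comp hinj.tendsto_cofinite).abs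
      rwa [Nat.cofinite_eq_atTop, abs_zero] at this
    exact abs_nonpos_iff.1 (ge_of_tendsto' hlim hle)

lemma sdecRe_comp_bijective {w : ℕ → ℝ} (hw : Antitone w) (hw_pos : ∀ n, 0 < w n) {σ : ℕ → ℕ}
    (hσ : Function.Bijective σ) (n : ℕ) :
    sdecRe (fun j => w (σ j)) n = ENNReal.ofReal (w n) := by
  let e := Equiv.ofBijective σ hσ
  have he : ∀ i, σ (e.symm i) = i := e.apply_symm_apply
  have habs : ∀ i, |w i| = w i := fun i => abs_of_pos (hw_pos i)
  have := sdecRe_eq (y := fun j => w (σ j)) e.symm.injective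
    (fun i j hij => by simpa only [he, habs] using hw hij)
    (fun j hj => absurd (e.symm.surjective j) hj) n
  simpa only [he, habs] using this

/-- Extension of an injection `k` to a bijection `σ` for which `σ ∘ k` fixes an initial segment
and grows at most like `2 i + 1`. -/
lemma exists_bijective_comp_le {k : ℕ → ℕ} (hk : Function.Injective k) (M : ℕ) :
    ∃ σ : ℕ → ℕ, Function.Bijective σ ∧ (∀ i < M, σ (k i) = i) ∧ ∀ i, σ (k i) ≤ 2 * i + 1 := by
  classical
  let p : ℕ → Prop := fun n => ∀ z ∉ Set.range k, n ≠ 2 * (M + z)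
  have hodd : ∀ i, p (2 * i + 1) := fun i z _ => by omega
  have hsmall : ∀ i < M, p i := fun i hi z _ => by omega
  have hcount : ∀ i, i < Nat.count p (2 * i + 2) := by
    intro i
    induction i with
    | zero =>
      rw [Nat.count_succ, if_pos (hodd 0)]; omega
    | succ i ih =>
      have h1 : Nat.count p (2 * i + 2) ≤ Nat.count p (2 * (i + 1) + 1) :=
        Nat.count_monotone p (by omega)
      rw [Nat.count_succ, if_pos (hodd (i + 1))]; omega
  have hinf : {n | p n}.Infinite :=
    Set.infinite_of_injective_forall_mem (f := fun i => 2 * i + 1)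
      (fun i j h => by dsimp only at h; omega) hodd
  have hpnth : ∀ i, p (Nat.nth p i) := Nat.nth_mem_of_infinite hinf
  let σ : ℕ → ℕ := fun n => if h : ∃ i, k i = n then Nat.nth p h.choose else 2 * (M + n)
  have hσk : ∀ i, σ (k i) = Nat.nth p i := by
    intro i
    have h : ∃ i', k i' = k i := ⟨i, rfl⟩
    simp only [σ, dif_pos h, hk h.choose_spec]
  have hσz : ∀ z ∉ Set.range k, σ z = 2 * (M + z) := fun z hz => dif_neg hz
  refine ⟨σ, ⟨fun a b hab => ?_, fun m => ?_⟩, fun i hi => ?_, fun i => ?_⟩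
  · by_cases ha : a ∈ Set.range k <;> by_cases hb : b ∈ Set.range k
    · obtain ⟨i, rfl⟩ := ha
      obtain ⟨j, rfl⟩ := hb
      rw [hσk, hσk] at hab
      rw [Nat.nth_injective hinf hab]
    · obtain ⟨i, rfl⟩ := ha
      rw [hσk, hσz b hb] at hab
      exact absurd hab (hpnth i b hb)
    · obtain ⟨j, rfl⟩ := hb
      rw [hσk, hσz a ha] at hab
      exact absurd hab.symm (hpnth j a ha)
    · rw [hσz a ha, hσz b hb] at hab
      omega
  · by_cases hm : p m
    · exact ⟨k (Nat.count p m), by rw [hσk, Nat.nth_count hm]⟩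
    · simp only [p, not_forall, not_not] at hm
      obtain ⟨z, hz, rfl⟩ := hm
      exact ⟨z, hσz z hz⟩
  · have hci : Nat.count p i = i := by
      rw [Nat.count_iff_forall]
      exact fun j hj => hsmall j (hj.trans hi)
    rw [hσk]
    conv_lhs => rw [← hci]
    exact Nat.nth_count (hsmall i hi)
  · rw [hσk]
    exact Nat.le_of_lt_succ (Nat.nth_lt_of_lt_count (hcount i))

end Rearrangement

section Modular

variable {φ : ℝ → ℝ}

/-- A rearrangement inequality for the perspective of an Orlicz function. -/
lemma IsOrliczFn.sum_perspective_le (hφ : IsOrliczFn φ) {a v w : ℕ → ℝ} (ha : Antitone a)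
    (ha0 : ∀ i, 0 ≤ a i) (hv : ∀ i, 0 < v i)
    (hvw : ∀ n, sdecRe v n = ENNReal.ofReal (w n)) (hw : ∀ n, 0 < w n) (N : ℕ) :
    ∀ k : ℕ → ℕ, Function.Injective k →
      ∑ i ∈ Finset.range N, φ (a i / w i) * w i ≤
        ∑ i ∈ Finset.range N, φ (a i / v (k i)) * v (k i) := by
  induction N with
  | zero => intro k _; simp
  | succ N ih =>
    intro k hk
    obtain ⟨j, hj, hjmin⟩ := Finset.exists_min_image (Finset.range (N + 1)) (fun i => v (k i))
      ⟨N, Finset.self_mem_range_succ N⟩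
    have hjN : j ≤ N := Nat.le_of_lt_succ (Finset.mem_range.1 hj)
    have hjw : v (k j) ≤ w N := by
      have := ofReal_le_sdecRe (y := v) (n := N) (m := v (k j)) hk fun i hi =>
        (hjmin i (Finset.mem_range.2 (Nat.lt_succ_of_le hi))).trans (le_abs_self _)
      rw [hvw] at this
      exact (ENNReal.ofReal_le_ofReal_iff (hw N).le).1 this
    have hlast : φ (a N / w N) * w N ≤ φ (a N / v (k j)) * v (k j) :=
      hφ.perspective_anti (ha0 N) (hv _) hjw
    have hrest := ih (k ∘ Equiv.swap j N) (hk.comp (Equiv.swap j N).injective)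
    refine (Finset.sum_range_succ _ _).trans_le ((add_le_add hrest hlast).trans ?_)
    rw [Finset.sum_range_succ]
    rcases hjN.eq_or_lt with rfl | hlt
    · simp
    · have hmem : j ∈ Finset.range N := Finset.mem_range.2 hlt
      rw [← Finset.add_sum_erase _ _ hmem, ← Finset.add_sum_erase _ _ hmem]
      have hcongr : ∑ i ∈ (Finset.range N).erase j,
            φ (a i / v ((k ∘ Equiv.swap j N) i)) * v ((k ∘ Equiv.swap j N) i) =
          ∑ i ∈ (Finset.range N).erase j, φ (a i / v (k i)) * v (k i) := by
        refine Finset.sum_congr rfl fun i hi => ?_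
        rw [Finset.mem_erase, Finset.mem_range] at hi
        rw [Function.comp_apply, Equiv.swap_apply_of_ne_of_ne hi.1 hi.2.ne]
      rw [hcongr, Function.comp_apply, Equiv.swap_apply_left]
      have := hφ.perspective_submodular (ha0 N) (ha hjN) (hv (k j))
        (hjmin N (Finset.self_mem_range_succ N))
      linarith

lemma IsOrliczFn.tsum_oterm_eq_top (hφ : IsOrliczFn φ) {x v : ℕ → ℝ} {δ b : ℝ} (hδ : 0 < δ)
    (hx : {j | δ ≤ |x j|}.Infinite) (hv : ∀ j, 0 < v j) (hvb : ∀ j, v j ≤ b) :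
    ∑' j, oterm φ |x j| (v j) = ∞ := by
  have hb : 0 < b := (hv 0).trans_le (hvb 0)
  have hpos : 0 < φ (δ / b) * b := by
    have := hφ.2.1 (Set.mem_Ici.2 le_rfl) (Set.mem_Ici.2 (by positivity)) (div_pos hδ hb)
    rw [hφ.2.2] at this
    positivity
  have := hx.to_subtype
  have hle : ∑' _ : {j | δ ≤ |x j|}, ENNReal.ofReal (φ (δ / b) * b) ≤
      ∑' j, oterm φ |x j| (v j) := by
    refine (ENNReal.tsum_le_tsum fun j => ?_).trans
      (ENNReal.tsum_comp_le_tsum_of_injective Subtype.val_injective _)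
    rw [oterm_of_pos (hv _)]
    exact ENNReal.ofReal_le_ofReal ((hφ.perspective_anti hδ.le (hv _) (hvb _)).trans
      (hφ.perspective_mono hδ.le j.2 (hv _)))
  rwa [ENNReal.tsum_const_eq_top_of_ne_zero (ENNReal.ofReal_pos.2 hpos).ne', top_le_iff] at hle

lemma IsOrliczFn.tsum_otermE_sdecRe_eq_top (hφ : IsOrliczFn φ) {x w : ℕ → ℝ} {δ : ℝ}
    (hδ : 0 < δ) (hx : {j | δ ≤ |x j|}.Infinite) (hw : Antitone w) (hw_pos : ∀ n, 0 < w n) :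
    ∑' n, otermE φ (sdecRe x n) (w n) = ∞ := by
  have := hx.to_subtype
  let k : ℕ → ℕ := fun i => (Infinite.natEmbedding {j | δ ≤ |x j|} i : ℕ)
  have hk : Function.Injective k :=
    Subtype.val_injective.comp (Infinite.natEmbedding {j | δ ≤ |x j|}).injective
  have hxδ : ∀ n, ENNReal.ofReal δ ≤ sdecRe x n := fun n =>
    ofReal_le_sdecRe hk fun j _ => (Infinite.natEmbedding {j | δ ≤ |x j|} j).2
  have hconst := hφ.tsum_oterm_eq_top (x := fun _ => δ) (δ := δ) hδ
    (by simpa [abs_of_pos hδ] using Set.infinite_univ) hw_pos (fun j => hw (Nat.zero_le j))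
  rw [abs_of_pos hδ] at hconst
  refine top_le_iff.1 (hconst.symm.trans_le (ENNReal.tsum_le_tsum fun n => ?_))
  rw [otermE]
  split_ifs with h
  · exact le_top
  · rw [oterm_of_pos (hw_pos n), oterm_of_pos (hw_pos n)]
    exact ENNReal.ofReal_le_ofReal (hφ.perspective_mono hδ.le
      ((ENNReal.ofReal_le_iff_le_toReal h).1 (hxδ n)) (hw_pos n))

lemma otermE_ofReal_abs (c v : ℝ) : otermE φ (ENNReal.ofReal |c|) v = oterm φ |c| v := by
  rw [otermE, if_neg ENNReal.ofReal_ne_top, ENNReal.toReal_ofReal (abs_nonneg c)]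

lemma exists_infinite_of_not_tendsto {x : ℕ → ℝ} (hx : ¬ Tendsto x cofinite (𝓝 0)) :
    ∃ δ > 0, {j | δ ≤ |x j|}.Infinite := by
  by_contra! h
  refine hx (Metric.tendsto_nhds.2 fun δ hδ => ?_)
  rw [Filter.eventually_cofinite]
  simpa using h δ hδ

lemma IsOrliczFn.tsum_otermE_sdecRe_le (hφ : IsOrliczFn φ) {x v w : ℕ → ℝ}
    (hw_pos : ∀ n, 0 < w n) (hv : ∀ n, 0 < v n)
    (hvw : ∀ n, sdecRe v n = ENNReal.ofReal (w n)) :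
    ∑' n, otermE φ (sdecRe x n) (w n) ≤ ∑' n, oterm φ |x n| (v n) := by
  by_cases hx : Tendsto x cofinite (𝓝 0)
  · obtain ⟨k, hk, hanti, hout⟩ := exists_antitone_enumeration hx
    have hxk := sdecRe_eq hk hanti fun j hj i => by simp [hout j hj]
    refine le_trans ?_ (ENNReal.tsum_comp_le_tsum_of_injective hk fun n => oterm φ |x n| (v n))
    simp only [hxk, otermE_ofReal_abs, oterm_of_pos (hw_pos _), oterm_of_pos (hv _)]
    refine ENNReal.tsum_le_of_sum_range_le fun N => ?_
    refine le_trans ?_ (ENNReal.sum_le_tsum (Finset.range N))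
    rw [← ENNReal.ofReal_sum_of_nonneg fun i _ =>
        hφ.perspective_nonneg (abs_nonneg _) (hw_pos i),
      ← ENNReal.ofReal_sum_of_nonneg fun i _ => hφ.perspective_nonneg (abs_nonneg _) (hv (k i))]
    exact ENNReal.ofReal_le_ofReal
      (hφ.sum_perspective_le hanti (fun _ => abs_nonneg _) hv hvw hw_pos N k hk)
  · obtain ⟨δ, hδ, hinf⟩ := exists_infinite_of_not_tendsto hx
    have hvb : ∀ j, v j ≤ w 0 := fun j => by
      have := ofReal_le_sdecRe (y := v) (n := 0) (m := v j) (add_left_injective j) fun i hi => by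
        obtain rfl := Nat.le_zero.1 hi
        simpa using le_abs_self (v j)
      rw [hvw] at this
      exact (ENNReal.ofReal_le_ofReal_iff (hw_pos 0).le).1 this
    rw [hφ.tsum_oterm_eq_top hδ hinf hv hvb]
    exact le_top

lemma IsOrliczFn.iInf_bijective_le (hφ : IsOrliczFn φ) {x w : ℕ → ℝ} (hw : Antitone w)
    (hw_pos : ∀ n, 0 < w n)
    (hctrl : ∃ K > 0, ∀ c > 0, ∀ n : ℕ,
      φ (c / w (2 * n + 1)) * w (2 * n + 1) ≤ K * (φ (c / w n) * w n)) :
    ⨅ σ ∈ {σ : ℕ → ℕ | Function.Bijective σ}, ∑' n, oterm φ |x n| (w (σ n)) ≤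
      ∑' n, otermE φ (sdecRe x n) (w n) := by
  by_cases hx : Tendsto x cofinite (𝓝 0)
  swap
  · obtain ⟨δ, hδ, hinf⟩ := exists_infinite_of_not_tendsto hx
    rw [hφ.tsum_otermE_sdecRe_eq_top hδ hinf hw hw_pos]
    exact le_top
  obtain ⟨K, hK, hctrl⟩ := hctrl
  obtain ⟨k, hk, hanti, hout⟩ := exists_antitone_enumeration hx
  have hxk := sdecRe_eq hk hanti fun j hj i => by simp [hout j hj]
  simp only [hxk, otermE_ofReal_abs]
  set h : ℕ → ℝ≥0∞ := fun i => oterm φ |x (k i)| (w i) with hh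
  by_cases htop : ∑' i, h i = ∞
  · rw [htop]
    exact le_top
  have hlim : Tendsto (fun M => ∑' i, h i + ENNReal.ofReal K * ∑' i, h (i + M)) atTop
      (𝓝 (∑' i, h i)) := by
    have h0 := ENNReal.Tendsto.const_mul (a := ENNReal.ofReal K)
      (ENNReal.tendsto_sum_nat_add h htop) (Or.inr ENNReal.ofReal_ne_top)
    simpa using h0.const_add (∑' i, h i)
  refine ge_of_tendsto' hlim fun M => ?_
  obtain ⟨σ, hσ, hfix, hgrow⟩ := exists_bijective_comp_le hk M
  refine (iInf₂_le σ hσ).trans ?_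
  have hsupp : Function.support (fun n => oterm φ |x n| (w (σ n))) ⊆ Set.range k := by
    intro n hn
    by_contra hnk
    exact hn (by simp [hout n hnk, hφ.oterm_zero (hw_pos _)])
  have hsplit := Summable.sum_add_tsum_nat_add' (k := M)
    (f := fun i => oterm φ |x (k i)| (w (σ (k i)))) ENNReal.summable
  rw [← hk.tsum_eq hsupp, ← hsplit, ← ENNReal.tsum_mul_left]
  refine add_le_add ?_ (ENNReal.tsum_le_tsum fun i => ?_)
  · refine le_of_eq_of_le (Finset.sum_congr rfl fun i hi => ?_)
      (ENNReal.sum_le_tsum (Finset.range M))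
    rw [hfix i (Finset.mem_range.1 hi)]
  · generalize i + M = n
    rcases (abs_nonneg (x (k n))).eq_or_lt with h0 | h0
    · rw [← h0, hφ.oterm_zero (hw_pos _)]
      exact zero_le
    · simp only [hh]
      rw [oterm_of_pos (hw_pos _), oterm_of_pos (hw_pos _), ← ENNReal.ofReal_mul hK.le]
      exact ENNReal.ofReal_le_ofReal ((hφ.perspective_anti h0.le (hw_pos _)
        (hw (hgrow n))).trans (hctrl _ h0 n))

end Modular

/-- for a positive decreasing `φ`-controlled weight sequence `w` (stated here
with `0`-based indexing, so the paper's condition at index `2n`, `n ≥ 1`, becomes the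
condition at `2n+1`) and any real sequence `x`, `∑ φ(x*(n)/w(n))·w(n)` equals the infimum
of `∑ φ(|x(n)|/v(n))·v(n)` over positive `v` with `v* = w`, and also the infimum of
`∑ φ(|x(n)|/w(σ(n)))·w(σ(n))` over all bijections `σ` of `ℕ`. -/
theorem statement6 (φ : ℝ → ℝ) (hφ : IsOrliczFn φ)
    (w : ℕ → ℝ) (hw_pos : ∀ n, 0 < w n)
    (hw_dec : ∀ m n : ℕ, m ≤ n → w n ≤ w m)
    (hctrl : ∃ K > 0, ∀ c > 0, ∀ n : ℕ,
      φ (c / w (2 * n + 1)) * w (2 * n + 1) ≤ K * (φ (c / w n) * w n))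
    (x : ℕ → ℝ) :
    (∑' n, otermE φ (sdecRe x n) (w n) =
      ⨅ v ∈ {v : ℕ → ℝ | (∀ n, 0 < v n) ∧ ∀ n, sdecRe v n = ENNReal.ofReal (w n)},
        ∑' n, oterm φ |x n| (v n)) ∧
    (∑' n, otermE φ (sdecRe x n) (w n) =
      ⨅ σ ∈ {σ : ℕ → ℕ | Function.Bijective σ},
        ∑' n, oterm φ |x n| (w (σ n))) := by
  have hw : Antitone w := fun m n h => hw_dec m n h
  have lower : ∑' n, otermE φ (sdecRe x n) (w n) ≤
      ⨅ v ∈ {v : ℕ → ℝ | (∀ n, 0 < v n) ∧ ∀ n, sdecRe v n = ENNReal.ofReal (w n)},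
        ∑' n, oterm φ |x n| (v n) :=
    le_iInf₂ fun v hv => hφ.tsum_otermE_sdecRe_le hw_pos hv.1 hv.2
  have middle : ⨅ v ∈ {v : ℕ → ℝ | (∀ n, 0 < v n) ∧ ∀ n, sdecRe v n = ENNReal.ofReal (w n)},
        ∑' n, oterm φ |x n| (v n) ≤
      ⨅ σ ∈ {σ : ℕ → ℕ | Function.Bijective σ}, ∑' n, oterm φ |x n| (w (σ n)) :=
    le_iInf₂ fun σ hσ => iInf₂_le (fun n => w (σ n))
      ⟨fun n => hw_pos (σ n), sdecRe_comp_bijective hw hw_pos hσ⟩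
  have upper := hφ.iInf_bijective_le (x := x) hw hw_pos hctrl
  exact ⟨le_antisymm lower (middle.trans upper), le_antisymm (lower.trans middle) upper⟩

end OrliczRearrangement

end
end
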